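/- Let K be a C^∞ function on an open neighborhood of the origin in ℝ². Then there exist an open neighborhood Ω of the origin and a function G ∈ C^∞(Ω) such that G > 0 on Ω, ∂²G/∂x² + K·G = 0 on Ω, G(0,y) = 1 and ∂G/∂x(0,y) = 0 for every y with (0,y) ∈ Ω, and moreover the Riemannian metric on Ω with components g₁₁ = 1, g₁₂ = g₂₁ = 0, g₂₂ = G² has Gaussian curvature equal to K on Ω. -/

import Mathlib

open Real Set Filter Topology

noncomputable section

/-- Partial derivative of `f : ℝ × ℝ → ℝ` in coordinate direction `i`. -/
def pd (i : Fin 2) (f : ℝ × ℝ → ℝ) (p : ℝ × ℝ) : ℝ :=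
  fderiv ℝ f p (if i = 0 then (1, 0) else (0, 1))

/-- The metric components as a 2×2 symmetric matrix of functions. -/
def gmat (g11 g12 g22 : ℝ × ℝ → ℝ) (i j : Fin 2) : ℝ × ℝ → ℝ :=
  if i = 0 then (if j = 0 then g11 else g12) else (if j = 0 then g12 else g22)

/-- The determinant of the metric. -/
def gdet (g11 g12 g22 : ℝ × ℝ → ℝ) (p : ℝ × ℝ) : ℝ :=
  g11 p * g22 p - g12 p ^ 2

/-- Components of the inverse metric. -/
def ginv (g11 g12 g22 : ℝ × ℝ → ℝ) (i j : Fin 2) (p : ℝ × ℝ) : ℝ :=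
  (if i = 0 then (if j = 0 then g22 p else -g12 p)
   else (if j = 0 then -g12 p else g11 p)) / gdet g11 g12 g22 p

/-- Christoffel symbols Γˡ_{ij}. -/
def Chr (g11 g12 g22 : ℝ × ℝ → ℝ) (l i j : Fin 2) (p : ℝ × ℝ) : ℝ :=
  (1 / 2) * ∑ m : Fin 2, ginv g11 g12 g22 l m p *
    (pd i (gmat g11 g12 g22 j m) p + pd j (gmat g11 g12 g22 i m) p
      - pd m (gmat g11 g12 g22 i j) p)

/-- Second covariant derivatives ∇_{ij} z. -/
def cov2 (g11 g12 g22 z : ℝ × ℝ → ℝ) (i j : Fin 2) (p : ℝ × ℝ) : ℝ :=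
  pd i (pd j z) p - ∑ l : Fin 2, Chr g11 g12 g22 l i j p * pd l z p

/-- |∇_g z|². -/
def gradSq (g11 g12 g22 z : ℝ × ℝ → ℝ) (p : ℝ × ℝ) : ℝ :=
  ∑ i : Fin 2, ∑ j : Fin 2, ginv g11 g12 g22 i j p * pd i z p * pd j z p

/-- The Gaussian curvature of the metric g. -/
def GaussK (g11 g12 g22 : ℝ × ℝ → ℝ) (p : ℝ × ℝ) : ℝ :=
  (1 / gdet g11 g12 g22 p) * ∑ i : Fin 2, gmat g11 g12 g22 0 i p *
    (pd 0 (Chr g11 g12 g22 i 1 1) p - pd 1 (Chr g11 g12 g22 i 0 1) p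
      + ∑ j : Fin 2, (Chr g11 g12 g22 j 1 1 p * Chr g11 g12 g22 i j 0 p
          - Chr g11 g12 g22 j 0 1 p * Chr g11 g12 g22 i j 1 p))

/-- Darboux's equation at a point p. -/
def DarbouxEq (g11 g12 g22 z : ℝ × ℝ → ℝ) (p : ℝ × ℝ) : Prop :=
  cov2 g11 g12 g22 z 0 0 p * cov2 g11 g12 g22 z 1 1 p
      - cov2 g11 g12 g22 z 0 1 p * cov2 g11 g12 g22 z 1 0 p
    = GaussK g11 g12 g22 p * gdet g11 g12 g22 p * (1 - gradSq g11 g12 g22 z p)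

/-- A smooth Riemannian metric on Ω. -/
def IsMetricOn (g11 g12 g22 : ℝ × ℝ → ℝ) (Ω : Set (ℝ × ℝ)) : Prop :=
  ContDiffOn ℝ (⊤ : ℕ∞) g11 Ω ∧ ContDiffOn ℝ (⊤ : ℕ∞) g12 Ω ∧ ContDiffOn ℝ (⊤ : ℕ∞) g22 Ω ∧
  ∀ p ∈ Ω, 0 < g11 p ∧ 0 < gdet g11 g12 g22 p

/-- The centers q_n = (1/n, 0). -/
def qpt (n : ℕ) : ℝ × ℝ := (1 / (n : ℝ), 0)

/-- Half-width of the square Xⁿ (whose width is 1/(2n(n+1))). -/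
def halfw (n : ℕ) : ℝ := 1 / (4 * (n : ℝ) * ((n : ℝ) + 1))

/-- The open axis-parallel square Xⁿ centered at q_n of width 1/(2n(n+1)). -/
def sqX (n : ℕ) : Set (ℝ × ℝ) :=
  {p | |p.1 - 1 / (n : ℝ)| < halfw n ∧ |p.2| < halfw n}

/-- The square X = (-1,1) × (-1,1). -/
def Xset : Set (ℝ × ℝ) := Ioo (-1 : ℝ) 1 ×ˢ Ioo (-1 : ℝ) 1

/-- φ is C^∞ on the closure of X, vanishes to infinite order on ∂X, and has a sign on X. -/
def PhiAdmissible (φ : ℝ × ℝ → ℝ) : Prop :=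
  ContDiffOn ℝ (⊤ : ℕ∞) φ (closure Xset) ∧
  (∀ k : ℕ, ∀ p ∈ frontier Xset, iteratedFDerivWithin ℝ k φ (closure Xset) p = 0) ∧
  ((∀ p ∈ Xset, 0 < φ p) ∨ (∀ p ∈ Xset, φ p < 0))

/-- K is obtained from φ and the sequence γ by the construction of the paper. -/
def Kconstr (φ : ℝ × ℝ → ℝ) (γ : ℕ → ℝ) (K : ℝ × ℝ → ℝ) : Prop :=
  (∀ n : ℕ, 1 ≤ n → ∀ q ∈ closure (sqX n),
      K q = γ n * φ ((4 * (n : ℝ) * ((n : ℝ) + 1)) • (q - qpt n))) ∧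
  (∀ q : ℝ × ℝ, q ∉ ⋃ n ∈ {m : ℕ | 1 ≤ m}, sqX n → K q = 0)

/-- Right vertical side +v_n of ∂Xⁿ. -/
def vSideR (n : ℕ) : Set (ℝ × ℝ) :=
  {p | p.1 = 1 / (n : ℝ) + halfw n ∧ |p.2| ≤ halfw n}

/-- Left vertical side -v_n of ∂Xⁿ. -/
def vSideL (n : ℕ) : Set (ℝ × ℝ) :=
  {p | p.1 = 1 / (n : ℝ) - halfw n ∧ |p.2| ≤ halfw n}

/-- Top horizontal side +h_n of ∂Xⁿ. -/
def hSideT (n : ℕ) : Set (ℝ × ℝ) :=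
  {p | p.2 = halfw n ∧ |p.1 - 1 / (n : ℝ)| ≤ halfw n}

/-- Bottom horizontal side -h_n of ∂Xⁿ. -/
def hSideB (n : ℕ) : Set (ℝ × ℝ) :=
  {p | p.2 = -halfw n ∧ |p.1 - 1 / (n : ℝ)| ≤ halfw n}

/-- At the point p there is a C³ change of coordinates Φ(x,y) = (x - p¹, s(x,y)) on a
neighborhood U ⊆ Ω of p, a C² function u and a positive continuous f on Φ(U), solving
∂_tt u + (K ∘ Φ⁻¹) ∂_ss u = (K ∘ Φ⁻¹) f on Φ(U). -/
def GoodChartAt (K : ℝ × ℝ → ℝ) (Ω : Set (ℝ × ℝ)) (p : ℝ × ℝ) : Prop :=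
  ∃ (U : Set (ℝ × ℝ)) (s : ℝ × ℝ → ℝ) (Ψ : ℝ × ℝ → ℝ × ℝ) (u f : ℝ × ℝ → ℝ),
    IsOpen U ∧ p ∈ U ∧ U ⊆ Ω ∧ ContDiffOn ℝ 3 s U ∧
    IsOpen ((fun q => (q.1 - p.1, s q)) '' U) ∧
    ContDiffOn ℝ 3 Ψ ((fun q => (q.1 - p.1, s q)) '' U) ∧
    (∀ q ∈ U, Ψ (q.1 - p.1, s q) = q) ∧
    (∀ w ∈ (fun q => (q.1 - p.1, s q)) '' U, ((Ψ w).1 - p.1, s (Ψ w)) = w) ∧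
    ContDiffOn ℝ 2 u ((fun q => (q.1 - p.1, s q)) '' U) ∧
    ContinuousOn f ((fun q => (q.1 - p.1, s q)) '' U) ∧
    (∀ w ∈ (fun q => (q.1 - p.1, s q)) '' U, 0 < f w) ∧
    (∀ w ∈ (fun q => (q.1 - p.1, s q)) '' U,
      pd 0 (pd 0 u) w + K (Ψ w) * pd 1 (pd 1 u) w = K (Ψ w) * f w)

section Superposition

variable {X : Type} [TopologicalSpace X] [CompactSpace X]
  {E : Type} [NormedAddCommGroup E] [NormedSpace ℝ E]
  {F : Type} [NormedAddCommGroup F] [NormedSpace ℝ F]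
  {G : Type} [NormedAddCommGroup G] [NormedSpace ℝ G]

/-- A continuous bilinear map applied pointwise to continuous functions. -/
def pointwiseBilin (B : E →L[ℝ] F →L[ℝ] G) : C(X, E) →L[ℝ] C(X, F) →L[ℝ] C(X, G) :=
  LinearMap.mkContinuous₂
    (LinearMap.mk₂ ℝ
      (fun (A : C(X, E)) (g : C(X, F)) => (⟨fun s => B (A s) (g s), by fun_prop⟩ : C(X, G)))
      (fun _ _ _ => by ext; simp) (fun _ _ _ => by ext; simp)
      (fun _ _ _ => by ext; simp) (fun _ _ _ => by ext; simp)) ‖B‖ (fun A g => by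
    refine (ContinuousMap.norm_le _ (by positivity)).2 fun s => ?_
    refine (B.le_opNorm₂ _ _).trans ?_
    gcongr
    · exact A.norm_coe_le_norm s
    · exact g.norm_coe_le_norm s)

lemma ContDiff.pointwiseBilin_left {H : Type} [NormedAddCommGroup H] [NormedSpace ℝ H]
    (B : E →L[ℝ] F →L[ℝ] G) {n : WithTop ℕ∞} {f : H → C(X, E)} (hf : ContDiff ℝ n f) :
    ContDiff ℝ n fun p => pointwiseBilin B (f p) :=
  ContDiff.comp (g := pointwiseBilin (X := X) B) (pointwiseBilin (X := X) B).contDiff hf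

lemma norm_sub_sub_fderiv_le {f : E → F} {C : NNReal} (hf : Differentiable ℝ f)
    (hC : LipschitzWith C (fderiv ℝ f)) (x y : E) :
    ‖f y - f x - fderiv ℝ f x (y - x)‖ ≤ C * ‖y - x‖ * ‖y - x‖ := by
  refine (convex_closedBall x ‖y - x‖).norm_image_sub_le_of_norm_hasFDerivWithin_le'
    (fun z _ => (hf z).hasFDerivAt.hasFDerivWithinAt) (fun z hz => ?_)
    (Metric.mem_closedBall_self (norm_nonneg _)) (by simp [dist_eq_norm])
  refine (hC.norm_sub_le z x).trans ?_
  gcongr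
  simpa [dist_eq_norm] using hz

/-- The superposition operator `g ↦ f ∘ g` is differentiable. -/
lemma hasFDerivAt_comp_continuousMap {f : E → F} {C : NNReal} (hf : ContDiff ℝ 1 f)
    (hC : LipschitzWith C (fderiv ℝ f)) (g : C(X, E)) :
    HasFDerivAt (fun g : C(X, E) => (⟨f, hf.continuous⟩ : C(E, F)).comp g)
      (pointwiseBilin (.id ℝ (E →L[ℝ] F))
        ((⟨fderiv ℝ f, hC.continuous⟩ : C(E, E →L[ℝ] F)).comp g)) g := by
  rw [hasFDerivAt_iff_isLittleO]
  refine Asymptotics.IsBigO.trans_isLittleO (g := fun h : C(X, E) => ‖h - g‖ ^ 2) ?_ ?_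
  · refine Asymptotics.IsBigO.of_bound C (Eventually.of_forall fun h => ?_)
    refine (ContinuousMap.norm_le _ (by positivity)).2 fun s => ?_
    refine (norm_sub_sub_fderiv_le (hf.differentiable one_ne_zero) hC (g s) (h s)).trans ?_
    have := (h - g).norm_coe_le_norm s
    rw [ContinuousMap.sub_apply] at this
    rw [Real.norm_of_nonneg (by positivity), sq, mul_assoc]
    gcongr
  · exact (Asymptotics.isLittleO_norm_pow_id one_lt_two).comp_tendsto
      (show Tendsto (fun h => h - g) (𝓝 g) (𝓝 0) from by
        have : ContinuousAt (fun h : C(X, E) => h - g) g := by fun_prop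
        simpa [ContinuousAt] using this)

/-- The superposition operator of a compactly supported smooth function is smooth. -/
lemma contDiff_comp_continuousMap {f : E → F} (hf : ContDiff ℝ (⊤ : ℕ∞) f)
    (hs : HasCompactSupport f) :
    ContDiff ℝ (⊤ : ℕ∞) (fun g : C(X, E) => (⟨f, hf.continuous⟩ : C(E, F)).comp g) := by
  refine contDiff_infty.2 fun n => ?_
  induction n generalizing F with
  | zero =>
    exact contDiff_zero.2 (ContinuousMap.continuous_postcomp _)
  | succ n ih =>
    have hf' : ContDiff ℝ (⊤ : ℕ∞) (fderiv ℝ f) := hf.fderiv_right (by simp)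
    obtain ⟨C, hC⟩ := hf'.lipschitzWith_of_hasCompactSupport (hs.fderiv (𝕜 := ℝ)) (by simp)
    exact contDiff_succ_iff_hasFDerivAt.2 ⟨_,
      (ih hf' (hs.fderiv (𝕜 := ℝ))).pointwiseBilin_left (.id ℝ (E →L[ℝ] F)),
      hasFDerivAt_comp_continuousMap (hf.of_le (by simp)) hC⟩

end Superposition

/-- The Volterra operator `v ↦ ∫₀ˢ v` on `C([-1, 1])`. -/
def volterra : C(Icc (-1 : ℝ) 1, ℝ) →L[ℝ] C(Icc (-1 : ℝ) 1, ℝ) :=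
  LinearMap.mkContinuous
    { toFun := fun v => ⟨fun s => ∫ r in (0 : ℝ)..s, IccExtend (by norm_num) v r,
        (intervalIntegral.continuous_primitive
          (fun a b => (v.continuous.Icc_extend' (h := by norm_num)).intervalIntegrable a b) 0).comp
          continuous_subtype_val⟩
      map_add' := fun v w => by
        ext s
        exact intervalIntegral.integral_add
          ((v.continuous.Icc_extend' (h := by norm_num)).intervalIntegrable _ _)
          ((w.continuous.Icc_extend' (h := by norm_num)).intervalIntegrable _ _)
      map_smul' := fun c v => by
        ext s
        exact intervalIntegral.integral_smul c (IccExtend (by norm_num) v) } 1 (fun v => by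
    refine (ContinuousMap.norm_le _ (by positivity)).2 fun s => ?_
    refine (intervalIntegral.norm_integral_le_of_norm_le_const
      (fun r _ => v.norm_coe_le_norm _)).trans ?_
    rw [one_mul, sub_zero]
    exact mul_le_of_le_one_right (norm_nonneg _) (abs_le.2 s.2))

lemma volterra_apply (v : C(Icc (-1 : ℝ) 1, ℝ)) (s : Icc (-1 : ℝ) 1) :
    volterra v s = ∫ r in (0 : ℝ)..s, IccExtend (by norm_num) v r := rfl

lemma hasDerivAt_volterra (v : C(Icc (-1 : ℝ) 1, ℝ)) {s : ℝ} (hs : s ∈ Ioo (-1 : ℝ) 1) :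
    HasDerivAt (IccExtend (by norm_num : (-1 : ℝ) ≤ 1) (volterra v))
      (IccExtend (by norm_num : (-1 : ℝ) ≤ 1) v s) s := by
  have hc := v.continuous.Icc_extend' (h := by norm_num)
  refine (intervalIntegral.integral_hasDerivAt_right (hc.intervalIntegrable 0 s)
    (hc.stronglyMeasurableAtFilter _ _) hc.continuousAt).congr_of_eventuallyEq ?_
  filter_upwards [Ioo_mem_nhds hs.1 hs.2] with t ht
  rw [IccExtend_of_mem _ _ (Ioo_subset_Icc_self ht), volterra_apply]

lemma volterra_zero (v : C(Icc (-1 : ℝ) 1, ℝ)) (h : (0 : ℝ) ∈ Icc (-1 : ℝ) 1) :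
    volterra v ⟨0, h⟩ = 0 := by
  simp [volterra_apply]

/-- Multiplication by `s` as a self-map of `[-1, 1]`. -/
def scaleMap (s : Icc (-1 : ℝ) 1) : C(Icc (-1 : ℝ) 1, Icc (-1 : ℝ) 1) :=
  ⟨fun t => ⟨s * t, abs_le.1 (by
    rw [abs_mul]
    exact mul_le_one₀ (abs_le.2 s.2) (abs_nonneg _) (abs_le.2 t.2))⟩, by fun_prop⟩

lemma volterra_comp_scaleMap (v : C(Icc (-1 : ℝ) 1, ℝ)) (s : Icc (-1 : ℝ) 1) :
    (volterra v).comp (scaleMap s) = (s : ℝ) • volterra (v.comp (scaleMap s)) := by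
  ext t
  simp only [ContinuousMap.comp_apply, ContinuousMap.smul_apply, volterra_apply]
  have : ∀ r ∈ uIcc (0 : ℝ) t, IccExtend (by norm_num) (v.comp (scaleMap s)) r
      = IccExtend (by norm_num : (-1 : ℝ) ≤ 1) v (s * r) := by
    intro r hr
    have hr1 : r ∈ Icc (-1 : ℝ) 1 :=
      uIcc_subset_Icc (by norm_num) t.2 hr
    change _ = IccExtend (by norm_num : (-1 : ℝ) ≤ 1) v (scaleMap s ⟨r, hr1⟩)
    rw [IccExtend_of_mem _ _ hr1, IccExtend_of_mem _ _ (scaleMap s ⟨r, hr1⟩).2]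
    rfl
  rw [intervalIntegral.integral_congr this, intervalIntegral.smul_integral_comp_mul_left]
  simp [scaleMap]


section Operators

variable {P W : Type} [NormedAddCommGroup W] [NormedSpace ℝ W]

lemma ContDiff.smul_comp_comp [NormedAddCommGroup P] [NormedSpace ℝ P] {c : P → ℝ} {B : P → W →L[ℝ] W} {n : WithTop ℕ∞} (A : W →L[ℝ] W)
    (hc : ContDiff ℝ n c) (hB : ContDiff ℝ n B) :
    ContDiff ℝ n fun p => c p • (A ∘L A ∘L B p) :=
  hc.smul (contDiff_const.clm_comp (contDiff_const.clm_comp hB))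

variable [CompleteSpace W]

lemma ContDiffAt.ringInverse_one_add_apply [NormedAddCommGroup P] [NormedSpace ℝ P]
    {T : P → W →L[ℝ] W} {p : P} {n : WithTop ℕ∞} (hT : ContDiffAt ℝ n T p)
    (hp : IsUnit (1 + T p)) (v : W) : ContDiffAt ℝ n (fun p => Ring.inverse (1 + T p) v) p := by
  obtain ⟨w, hw⟩ := hp
  have h1 : ContDiffAt ℝ n (fun p => Ring.inverse (1 + T p)) p := by
    refine ContDiffAt.comp p (g := Ring.inverse) ?_ (contDiffAt_const.add hT)
    rw [← hw]
    exact contDiffAt_ringInverse ℝ w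
  exact h1.clm_apply contDiffAt_const

lemma eventually_isUnit_one_add [TopologicalSpace P] {T : P → W →L[ℝ] W} {p : P} (hT : Continuous T) (hp : IsUnit (1 + T p)) :
    ∀ᶠ q in 𝓝 p, IsUnit (1 + T q) :=
  (continuous_const.add hT).continuousAt.eventually_mem (Units.isOpen.mem_nhds hp)

end Operators

section Jacobi

/-- The affine path `s ↦ (s x, y)` on `[-1, 1]`, for `p = (x, y)`. -/
def horizontalPath (p : ℝ × ℝ) : C(Icc (-1 : ℝ) 1, ℝ × ℝ) :=
  p.1 • ⟨fun s => ((s : ℝ), (0 : ℝ)), by fun_prop⟩ + p.2 • ContinuousMap.const _ ((0 : ℝ), (1 : ℝ))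

lemma horizontalPath_apply (p : ℝ × ℝ) (s : Icc (-1 : ℝ) 1) :
    horizontalPath p s = (s * p.1, p.2) := by
  simp [horizontalPath, mul_comm]

lemma contDiff_horizontalPath : ContDiff ℝ (⊤ : ℕ∞) horizontalPath := by
  unfold horizontalPath
  fun_prop

/-- The operator `v ↦ x² ∫₀ˢ ∫₀ʳ κ(t x, y) v(t)` on `C([-1, 1])`, for `p = (x, y)`. -/
def jacobiOp (κ : C(ℝ × ℝ, ℝ)) (p : ℝ × ℝ) : C(Icc (-1 : ℝ) 1, ℝ) →L[ℝ] C(Icc (-1 : ℝ) 1, ℝ) :=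
  p.1 ^ 2 • (volterra ∘L volterra ∘L
    pointwiseBilin (ContinuousLinearMap.mul ℝ ℝ) (κ.comp (horizontalPath p)))

lemma jacobiOp_apply (κ : C(ℝ × ℝ, ℝ)) (p : ℝ × ℝ) (v : C(Icc (-1 : ℝ) 1, ℝ)) :
    jacobiOp κ p v = p.1 ^ 2 • volterra (volterra (κ.comp (horizontalPath p) * v)) := rfl

lemma contDiff_jacobiOp {κ : C(ℝ × ℝ, ℝ)} (hκ : ContDiff ℝ (⊤ : ℕ∞) κ) (hs : HasCompactSupport κ) :
    ContDiff ℝ (⊤ : ℕ∞) (jacobiOp κ) := by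
  have h : ContDiff ℝ (⊤ : ℕ∞) fun p => κ.comp (horizontalPath p) :=
    (contDiff_comp_continuousMap hκ hs).comp contDiff_horizontalPath
  have h2 := h.pointwiseBilin_left (ContinuousLinearMap.mul ℝ ℝ)
  exact .smul_comp_comp volterra (contDiff_fst.pow 2) h2

/-- The solution `v` on `[-1, 1]` of `∂²v/∂s² + x² κ(s x, y) v = 0`, `v(0) = 1`, `∂v/∂s(0) = 0`. -/
def jacobiPath (κ : C(ℝ × ℝ, ℝ)) (p : ℝ × ℝ) : C(Icc (-1 : ℝ) 1, ℝ) :=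
  Ring.inverse (1 + jacobiOp κ p) 1

/-- The solution of `∂²G/∂x² + κ G = 0`, `G(0, y) = 1`, `∂G/∂x(0, y) = 0`. -/
def jacobiSol (κ : C(ℝ × ℝ, ℝ)) (p : ℝ × ℝ) : ℝ :=
  jacobiPath κ p ⟨1, by norm_num⟩

variable {κ : C(ℝ × ℝ, ℝ)} {p : ℝ × ℝ}

lemma contDiffAt_jacobiSol (hκ : ContDiff ℝ (⊤ : ℕ∞) κ) (hs : HasCompactSupport κ)
    (hp : IsUnit (1 + jacobiOp κ p)) : ContDiffAt ℝ (⊤ : ℕ∞) (jacobiSol κ) p := by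
  have h := (contDiff_jacobiOp hκ hs).contDiffAt.ringInverse_one_add_apply hp 1
  exact (ContinuousMap.evalCLM ℝ _).contDiff.contDiffAt.comp p h

lemma jacobiPath_add (hp : IsUnit (1 + jacobiOp κ p)) :
    jacobiPath κ p + jacobiOp κ p (jacobiPath κ p) = 1 := by
  have := congrArg (fun A : C(Icc (-1 : ℝ) 1, ℝ) →L[ℝ] C(Icc (-1 : ℝ) 1, ℝ) => A 1)
    (Ring.mul_inverse_cancel _ hp)
  exact this

lemma eq_jacobiPath (hp : IsUnit (1 + jacobiOp κ p)) {v : C(Icc (-1 : ℝ) 1, ℝ)}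
    (hv : v + jacobiOp κ p v = 1) : v = jacobiPath κ p := by
  have := congrArg (fun A : C(Icc (-1 : ℝ) 1, ℝ) →L[ℝ] C(Icc (-1 : ℝ) 1, ℝ) => A v)
    (Ring.inverse_mul_cancel _ hp)
  rw [jacobiPath, ← hv]
  exact this.symm

lemma jacobiOp_comp_scaleMap (v : C(Icc (-1 : ℝ) 1, ℝ)) (s : Icc (-1 : ℝ) 1) :
    jacobiOp κ (s * p.1, p.2) (v.comp (scaleMap s)) = (jacobiOp κ p v).comp (scaleMap s) := by
  have h : (κ.comp (horizontalPath p) * v).comp (scaleMap s)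
      = κ.comp (horizontalPath (s * p.1, p.2)) * v.comp (scaleMap s) := by
    ext t
    simp only [ContinuousMap.comp_apply, ContinuousMap.mul_apply, horizontalPath_apply, scaleMap,
      ContinuousMap.coe_mk]
    ring_nf
  rw [jacobiOp_apply, jacobiOp_apply, ContinuousMap.smul_comp, volterra_comp_scaleMap,
    volterra_comp_scaleMap, h, map_smul, smul_smul, smul_smul]
  ring_nf

lemma jacobiSol_mul (s : Icc (-1 : ℝ) 1) (hp : IsUnit (1 + jacobiOp κ p))
    (hsp : IsUnit (1 + jacobiOp κ (s * p.1, p.2))) :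
    jacobiSol κ (s * p.1, p.2) = jacobiPath κ p s := by
  have h : (jacobiPath κ p).comp (scaleMap s) = jacobiPath κ (s * p.1, p.2) := by
    refine eq_jacobiPath hsp ?_
    rw [jacobiOp_comp_scaleMap, ← ContinuousMap.add_comp, jacobiPath_add hp]
    rfl
  rw [jacobiSol, ← h, ContinuousMap.comp_apply]
  congr 1
  ext
  simp [scaleMap]

/-- The `x`-derivatives of `jacobiSol`. -/
lemma exists_hasDerivAt_jacobiSol {a y : ℝ} (ha : 0 < a)
    (hu : ∀ t ∈ Icc (-a) a, IsUnit (1 + jacobiOp κ (t, y))) :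
    jacobiSol κ (0, y) = 1 ∧ ∃ w : ℝ → ℝ, w 0 = 0 ∧ ∀ x ∈ Ioo (-a) a,
      HasDerivAt (fun t => jacobiSol κ (t, y)) (w x) x ∧
      HasDerivAt w (-(κ (x, y) * jacobiSol κ (x, y))) x := by
  have hle : (-1 : ℝ) ≤ 1 := by norm_num
  set u := jacobiPath κ (a, y) with hu_def
  set q := κ.comp (horizontalPath (a, y)) * u with hq
  have hua := jacobiPath_add (hu a ⟨by linarith, le_rfl⟩)
  rw [jacobiOp_apply, ← hu_def, ← hq] at hua
  have hdiv : ∀ t ∈ Icc (-a) a, t / a ∈ Icc (-1 : ℝ) 1 := fun t ht =>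
    ⟨by rw [le_div_iff₀ ha]; linarith [ht.1], by rw [div_le_iff₀ ha]; linarith [ht.2]⟩
  have hsol : ∀ t (ht : t ∈ Icc (-a) a), jacobiSol κ (t, y) = u ⟨t / a, hdiv t ht⟩ := by
    intro t ht
    have h := jacobiSol_mul (κ := κ) (p := (a, y)) ⟨t / a, hdiv t ht⟩ (hu a ⟨by linarith, le_rfl⟩)
    simp only [div_mul_cancel₀ t ha.ne'] at h
    exact h (hu t ht)
  have hval : ∀ t (ht : t ∈ Icc (-a) a),
      jacobiSol κ (t, y) = 1 - a ^ 2 * IccExtend hle (volterra (volterra q)) (t / a) := by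
    intro t ht
    rw [hsol t ht, IccExtend_of_mem _ _ (hdiv t ht), eq_sub_iff_add_eq]
    exact congrArg (fun v : C(Icc (-1 : ℝ) 1, ℝ) => v ⟨t / a, hdiv t ht⟩) hua
  have hzero : ∀ v, IccExtend hle (volterra v) (0 / a) = 0 := by
    intro v
    rw [zero_div, IccExtend_of_mem hle _ (by norm_num), volterra_zero]
  refine ⟨by rw [hval 0 ⟨by linarith, ha.le⟩, hzero]; ring,
    fun t => -a * IccExtend hle (volterra q) (t / a), by beta_reduce; rw [hzero, mul_zero], fun x hx => ?_⟩
  have hxa : x / a ∈ Ioo (-1 : ℝ) 1 :=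
    ⟨by rw [lt_div_iff₀ ha]; linarith [hx.1], by rw [div_lt_iff₀ ha]; linarith [hx.2]⟩
  have hd : HasDerivAt (fun t : ℝ => t / a) (1 / a) x := (hasDerivAt_id x).div_const a
  constructor
  · refine HasDerivAt.congr_of_eventuallyEq ?_
      (f := fun t => 1 - a ^ 2 * IccExtend hle (volterra (volterra q)) (t / a)) ?_
    · refine ((((hasDerivAt_volterra (volterra q) hxa).comp x hd).const_mul
        (a ^ 2)).const_sub 1).congr_deriv ?_
      field_simp
    · filter_upwards [Ioo_mem_nhds hx.1 hx.2] with t ht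
      exact hval t (Ioo_subset_Icc_self ht)
  · refine (((hasDerivAt_volterra q hxa).comp x hd).const_mul (-a)).congr_deriv ?_
    rw [IccExtend_of_mem _ _ (Ioo_subset_Icc_self hxa), hsol x (Ioo_subset_Icc_self hx), hq,
      ContinuousMap.mul_apply, ContinuousMap.comp_apply, horizontalPath_apply]
    simp only [div_mul_cancel₀ x ha.ne']
    field_simp

lemma eventually_jacobiSol (hκ : ContDiff ℝ (⊤ : ℕ∞) κ) (hs : HasCompactSupport κ) :
    ∀ᶠ p in 𝓝 (0 : ℝ × ℝ), IsUnit (1 + jacobiOp κ p) ∧ 0 < jacobiSol κ p := by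
  have h0 : jacobiOp κ 0 = 0 :=
    ContinuousLinearMap.ext fun v => by rw [jacobiOp_apply]; simp
  have hu : IsUnit (1 + jacobiOp κ 0) := by simp [h0]
  refine .and ?_ ?_
  · exact eventually_isUnit_one_add (contDiff_jacobiOp hκ hs).continuous hu
  · refine (contDiffAt_jacobiSol hκ hs hu).continuousAt.eventually (lt_mem_nhds ?_)
    simp [jacobiSol, jacobiPath, h0]

end Jacobi

section Curvature

lemma pd_zero_eq_of_hasDerivAt {f : ℝ × ℝ → ℝ} {p : ℝ × ℝ} {d : ℝ} (hf : DifferentiableAt ℝ f p)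
    (hd : HasDerivAt (fun t => f (t, p.2)) d p.1) : pd 0 f p = d := by
  have h1 : HasDerivAt (fun t : ℝ => (t, p.2)) ((1 : ℝ), (0 : ℝ)) p.1 :=
    (hasDerivAt_id p.1).prodMk (hasDerivAt_const p.1 p.2)
  have h2 := HasFDerivAt.comp_hasDerivAt (f := fun t : ℝ => (t, p.2)) p.1 hf.hasFDerivAt h1
  exact h2.unique hd

lemma pd_const (i : Fin 2) (c : ℝ) (p : ℝ × ℝ) : pd i (fun _ => c) p = 0 := by
  simp [pd]

lemma pd_mul (i : Fin 2) {f g : ℝ × ℝ → ℝ} {p : ℝ × ℝ} (hf : DifferentiableAt ℝ f p)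
    (hg : DifferentiableAt ℝ g p) :
    pd i (fun q => f q * g q) p = f p * pd i g p + pd i f p * g p := by
  simp only [pd]
  rw [fderiv_fun_mul hf hg]
  simp [mul_comm]

lemma ContDiffAt.pd {f : ℝ × ℝ → ℝ} {p : ℝ × ℝ} (i : Fin 2) (hf : ContDiffAt ℝ (⊤ : ℕ∞) f p) :
    ContDiffAt ℝ (⊤ : ℕ∞) (pd i f) p :=
  (hf.fderiv_right (by simp)).clm_apply contDiffAt_const

/-- The Gaussian curvature of `dx² + G² dy²` is `-(∂²G/∂x²) / G`. -/
lemma gaussK_geodesic_coordinates {G : ℝ × ℝ → ℝ} {p : ℝ × ℝ} (hG : ContDiffAt ℝ (⊤ : ℕ∞) G p)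
    (hp : G p ≠ 0) :
    GaussK (fun _ => 1) (fun _ => 0) (fun q => G q ^ 2) p = -pd 0 (pd 0 G) p / G p := by
  have hsq : ∀ᶠ q in 𝓝 p, pd 0 (fun q => G q ^ 2) q = 2 * (G q * pd 0 G q) := by
    filter_upwards [(hG.of_le (m := 1) (by simp)).eventually (by simp)] with q hq
    have hd := hq.differentiableAt one_ne_zero
    simp only [sq]
    rw [pd_mul 0 hd hd]
    ring
  have hdG := hG.differentiableAt (by simp)
  have hdG' := (hG.pd 0).differentiableAt (by simp)
  have h011 : Chr (fun _ => 1) (fun _ => 0) (fun q => G q ^ 2) 0 1 1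
      =ᶠ[𝓝 p] fun q => (-G q) * pd 0 G q := by
    filter_upwards [hsq, hG.continuousAt.eventually_ne hp] with q hq hq0
    simp [Chr, Fin.sum_univ_two, gmat, ginv, gdet, pd_const, hq]
    field_simp
  have h001 : Chr (fun _ => 1) (fun _ => 0) (fun q => G q ^ 2) 0 0 1 = fun _ => 0 := by
    ext q
    simp [Chr, Fin.sum_univ_two, gmat, ginv, gdet, pd_const]
  have h010 : Chr (fun _ => 1) (fun _ => 0) (fun q => G q ^ 2) 0 1 0 p = 0 := by
    simp [Chr, Fin.sum_univ_two, gmat, ginv, gdet, pd_const]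
  have h000 : Chr (fun _ => 1) (fun _ => 0) (fun q => G q ^ 2) 0 0 0 p = 0 := by
    simp [Chr, Fin.sum_univ_two, gmat, ginv, gdet, pd_const]
  have h101 : Chr (fun _ => 1) (fun _ => 0) (fun q => G q ^ 2) 1 0 1 p = pd 0 G p / G p := by
    simp [Chr, Fin.sum_univ_two, gmat, ginv, gdet, pd_const, hsq.self_of_nhds]
    field_simp
  have hpd : pd 0 (Chr (fun _ => 1) (fun _ => 0) (fun q => G q ^ 2) 0 1 1) p
      = -(G p * pd 0 (pd 0 G) p + pd 0 G p ^ 2) := by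
    have hneg : pd 0 (fun q => -G q) p = -pd 0 G p := by
      simp only [pd]
      rw [fderiv_fun_neg]
      rfl
    rw [pd, h011.fderiv_eq, ← pd, pd_mul 0 hdG.fun_neg hdG', hneg]
    ring
  rw [GaussK]
  simp only [Fin.sum_univ_two, h001, h010, h000, h101, hpd, pd_const, h011.self_of_nhds]
  simp [gmat, gdet]
  field_simp
  ring

end Curvature

/-- A smooth function agrees near any point of its domain with a compactly supported one. -/
lemma exists_contDiff_hasCompactSupport_eventuallyEq {f : ℝ × ℝ → ℝ} {V : Set (ℝ × ℝ)} {x : ℝ × ℝ}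
    (hV : V ∈ 𝓝 x) (hf : ContDiffOn ℝ (⊤ : ℕ∞) f V) :
    ∃ g : ℝ × ℝ → ℝ, ContDiff ℝ (⊤ : ℕ∞) g ∧ HasCompactSupport g ∧ g =ᶠ[𝓝 x] f := by
  obtain ⟨r, hr, hrV⟩ := Metric.nhds_basis_closedBall.mem_iff.1 (interior_mem_nhds.2 hV)
  let b : ContDiffBump x := ⟨r / 2, r, half_pos hr, half_lt_self hr⟩
  refine ⟨fun q => b q * f q, contDiff_iff_contDiffAt.2 fun q => ?_, b.hasCompactSupport.mul_right,
    ?_⟩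
  · by_cases hq : q ∈ tsupport b
    · rw [b.tsupport_eq] at hq
      exact b.contDiffAt.mul (hf.contDiffAt (mem_interior_iff_mem_nhds.1 (hrV hq)))
    · refine (contDiffAt_const (c := (0 : ℝ))).congr_of_eventuallyEq ?_
      filter_upwards [notMem_tsupport_iff_eventuallyEq.1 hq] with z hz
      simp [hz]
  · filter_upwards [b.eventuallyEq_one] with z hz
    simp [hz]

theorem exists_metric_with_curvature_K
    (K : ℝ × ℝ → ℝ) (V : Set (ℝ × ℝ)) (hV : IsOpen V) (h0V : (0, 0) ∈ V)
    (hK : ContDiffOn ℝ (⊤ : ℕ∞) K V) :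
    ∃ (Ω : Set (ℝ × ℝ)) (G : ℝ × ℝ → ℝ),
      IsOpen Ω ∧ (0, 0) ∈ Ω ∧ Ω ⊆ V ∧
      ContDiffOn ℝ (⊤ : ℕ∞) G Ω ∧
      (∀ p ∈ Ω, 0 < G p) ∧
      (∀ p ∈ Ω, pd 0 (pd 0 G) p + K p * G p = 0) ∧
      (∀ y : ℝ, ((0 : ℝ), y) ∈ Ω → G (0, y) = 1 ∧ pd 0 G (0, y) = 0) ∧
      (∀ p ∈ Ω, GaussK (fun _ => 1) (fun _ => 0) (fun q => (G q) ^ 2) p = K p) := by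
  obtain ⟨g, hg, hgs, hgK⟩ :=
    exists_contDiff_hasCompactSupport_eventuallyEq (hV.mem_nhds h0V) hK
  set κ : C(ℝ × ℝ, ℝ) := ⟨g, hg.continuous⟩
  obtain ⟨δ, hδ, hball⟩ := Metric.eventually_nhds_iff_ball.1
    ((hV.eventually_mem h0V).and (hgK.and (eventually_jacobiSol (κ := κ) hg hgs)))
  have hmem : ∀ x y : ℝ, (x, y) ∈ Metric.ball (0 : ℝ × ℝ) δ ↔ |x| < δ ∧ |y| < δ := by
    simp [Prod.norm_def]
  have hsmooth : ∀ p ∈ Metric.ball (0 : ℝ × ℝ) δ, ContDiffAt ℝ (⊤ : ℕ∞) (jacobiSol κ) p :=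
    fun p hp => contDiffAt_jacobiSol hg hgs (hball p hp).2.2.1
  have hpos : ∀ p ∈ Metric.ball (0 : ℝ × ℝ) δ, 0 < jacobiSol κ p := fun p hp =>
    (hball p hp).2.2.2
  have hline : ∀ x y : ℝ, (x, y) ∈ Metric.ball (0 : ℝ × ℝ) δ → ∃ a, 0 < a ∧ x ∈ Ioo (-a) a ∧
      ∀ t ∈ Icc (-a) a, (t, y) ∈ Metric.ball (0 : ℝ × ℝ) δ := by
    intro x y hxy
    obtain ⟨hx, hy⟩ := (hmem x y).1 hxy
    obtain ⟨a, hxa, haδ⟩ := exists_between hx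
    exact ⟨a, (abs_nonneg x).trans_lt hxa, abs_lt.1 hxa,
      fun t ht => (hmem t y).2 ⟨(abs_le.2 ht).trans_lt haδ, hy⟩⟩
  have hderiv : ∀ x y : ℝ, (x, y) ∈ Metric.ball (0 : ℝ × ℝ) δ →
      jacobiSol κ (0, y) = 1 ∧ pd 0 (jacobiSol κ) (0, y) = 0 ∧
      pd 0 (pd 0 (jacobiSol κ)) (x, y) = -(K (x, y) * jacobiSol κ (x, y)) := by
    intro x y hxy
    obtain ⟨a, ha, hxa, hat⟩ := hline x y hxy
    obtain ⟨h1, w, hw0, hw⟩ := exists_hasDerivAt_jacobiSol (κ := κ) ha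
      fun t ht => (hball _ (hat t ht)).2.2.1
    have hpd : ∀ t ∈ Ioo (-a) a, pd 0 (jacobiSol κ) (t, y) = w t := fun t ht =>
      pd_zero_eq_of_hasDerivAt
        ((hsmooth _ (hat t (Ioo_subset_Icc_self ht))).differentiableAt (by simp)) (hw t ht).1
    refine ⟨h1, (hpd 0 ⟨by linarith, ha⟩).trans hw0, ?_⟩
    rw [← (hball _ hxy).2.1]
    refine pd_zero_eq_of_hasDerivAt (((hsmooth _ hxy).pd 0).differentiableAt (by simp))
      ((hw x hxa).2.congr_of_eventuallyEq ?_)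
    filter_upwards [Ioo_mem_nhds hxa.1 hxa.2] with t ht using hpd t ht
  refine ⟨Metric.ball 0 δ, jacobiSol κ, Metric.isOpen_ball, Metric.mem_ball_self hδ,
    fun p hp => (hball p hp).1, fun p hp => (hsmooth p hp).contDiffWithinAt, hpos,
    fun p hp => ?_, fun y hy => ⟨(hderiv 0 y hy).1, (hderiv 0 y hy).2.1⟩, fun p hp => ?_⟩
  · rw [(hderiv p.1 p.2 hp).2.2]
    ring
  · rw [gaussK_geodesic_coordinates (hsmooth p hp) (hpos p hp).ne', (hderiv p.1 p.2 hp).2.2,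
      neg_neg]
    exact mul_div_cancel_right₀ _ (hpos p hp).ne'

end
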